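/- arXiv:2312.10495 — 7 statements merged into one kernel-verified Lean document; each statement's English description precedes it below -/
import Mathlib

section
/- Let S be a nonempty subset of [0, ∞) × [0, 1], let α ∈ ℝ, and define q(λ) = inf{ C - λ·V + λ·α : (C, V) ∈ S }. Let λ* ≥ 0 satisfy q(λ*) ≥ q(λ) for all λ ≥ 0 (λ* maximizes the dual function over the nonnegative reals). If λ₀ ≥ 0 and (C₀, V₀) ∈ S is λ₀-optimal in S, then: V₀ < α implies λ₀ ≤ λ*, and V₀ > α implies λ₀ ≥ λ*. -/
/-- Bisection test: let `λ*` maximize the dual function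
`q(λ) = inf { C - λ·V + λ·α : (C, V) ∈ S }` over `λ ≥ 0`, with
`S ⊆ [0, ∞) × [0, 1]` nonempty. If `(C₀, V₀) ∈ S` is λ₀-optimal in `S` with `λ₀ ≥ 0`,
then `V₀ < α` implies `λ₀ ≤ λ*` and `V₀ > α` implies `λ₀ ≥ λ*`. -/
theorem bisection_test_for_dual_maximizer
    (S : Set (ℝ × ℝ)) (hS : S.Nonempty)
    (hsub : S ⊆ Set.Ici (0 : ℝ) ×ˢ Set.Icc (0 : ℝ) 1) (α : ℝ)
    (q : ℝ → ℝ)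
    (hq : ∀ lam : ℝ, q lam = sInf ((fun p : ℝ × ℝ => p.1 - lam * p.2 + lam * α) '' S))
    (lamstar : ℝ) (hstar0 : 0 ≤ lamstar)
    (hmax : ∀ lam : ℝ, 0 ≤ lam → q lam ≤ q lamstar)
    (lam₀ : ℝ) (hlam₀ : 0 ≤ lam₀)
    (C₀ V₀ : ℝ) (hmem : (C₀, V₀) ∈ S)
    (hopt : ∀ p ∈ S, C₀ - lam₀ * V₀ ≤ p.1 - lam₀ * p.2) :
    (V₀ < α → lam₀ ≤ lamstar) ∧ (α < V₀ → lamstar ≤ lam₀) := by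
  have h1 : C₀ - lam₀ * V₀ + lam₀ * α ≤ q lam₀ := by
    rw [hq]
    apply le_csInf (hS.image _)
    rintro _ ⟨p, hp, rfl⟩
    have := hopt p hp
    simp only
    linarith
  have h2 : q lamstar ≤ C₀ - lamstar * V₀ + lamstar * α := by
    rw [hq]
    refine csInf_le ⟨-lamstar + lamstar * α, ?_⟩ ⟨(C₀, V₀), hmem, rfl⟩
    rintro _ ⟨p, hp, rfl⟩
    obtain ⟨hC, _, hV⟩ := hsub hp
    have hC' : 0 ≤ p.1 := hC
    have := mul_le_mul_of_nonneg_left hV hstar0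
    simp only
    linarith
  have h3 := hmax lam₀ hlam₀
  constructor
  · intro h
    by_contra! hc
    nlinarith [mul_pos (sub_pos.2 h) (sub_pos.2 hc)]
  · intro h
    by_contra! hc
    nlinarith [mul_pos (sub_pos.2 h) (sub_pos.2 hc)]
end

section
/- Let S be a nonempty, convex, compact subset of ℝ × ℝ and let α ∈ ℝ be such that the feasible set {(C, V) ∈ S : V ≥ α} is nonempty. Then sup{ inf{ C - λ·V + λ·α : (C, V) ∈ S } : λ ≥ 0 } = min{ C : (C, V) ∈ S, V ≥ α }; in particular the primal minimum on the right-hand side is attained and there is no duality gap. -/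
/-- Strong duality for the joint chance constrained problem over a nonempty, convex,
compact performance set `S ⊆ ℝ × ℝ` with nonempty feasible set `{(C, V) ∈ S : V ≥ α}`:
the supremum over `λ ≥ 0` of `inf { C - λ·V + λ·α : (C, V) ∈ S }` equals the minimum of
`C` over the feasible set, and this primal minimum is attained. -/
theorem strong_duality_chance_constrained
    (S : Set (ℝ × ℝ)) (hS : S.Nonempty) (hconv : Convex ℝ S) (hcomp : IsCompact S)
    (α : ℝ) (hfeas : ∃ p ∈ S, α ≤ p.2) :
    ∃ Cmin : ℝ,
      (∃ p ∈ S, α ≤ p.2 ∧ p.1 = Cmin) ∧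
      (∀ p ∈ S, α ≤ p.2 → Cmin ≤ p.1) ∧
      sSup {y : ℝ | ∃ lam : ℝ, 0 ≤ lam ∧
        y = sInf ((fun p : ℝ × ℝ => p.1 - lam * p.2 + lam * α) '' S)} = Cmin := by
  have hK : IsCompact (S ∩ {p : ℝ × ℝ | α ≤ p.2}) :=
    hcomp.inter_right (isClosed_le continuous_const continuous_snd)
  obtain ⟨p0, hp0, hp0S⟩ := hfeas
  obtain ⟨q, ⟨hqS, hqα⟩, hq⟩ := hK.exists_isMinOn ⟨p0, hp0, hp0S⟩ continuous_fst.continuousOn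
  have hmin : ∀ p ∈ S, α ≤ p.2 → q.1 ≤ p.1 := fun p hp h => hq ⟨hp, h⟩
  refine ⟨q.1, ⟨q, hqS, hqα, rfl⟩, hmin, ?_⟩
  have hbdd : ∀ lam : ℝ, BddBelow ((fun p : ℝ × ℝ => p.1 - lam * p.2 + lam * α) '' S) :=
    fun lam => (hcomp.image (by fun_prop)).bddBelow
  apply csSup_eq_of_forall_le_of_forall_lt_exists_gt
  · exact ⟨_, 0, le_rfl, rfl⟩
  · rintro y ⟨lam, hl, rfl⟩
    refine (csInf_le (hbdd lam) ⟨q, hqS, rfl⟩).trans ?_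
    have : lam * α ≤ lam * q.2 := mul_le_mul_of_nonneg_left hqα hl
    simp only
    linarith
  · intro w hw
    obtain ⟨m, hwm, hm⟩ := exists_between hw
    have hdisj : Disjoint S (Set.Iic m ×ˢ Set.Ici α) := by
      rw [Set.disjoint_left]
      rintro p hp ⟨h1, h2⟩
      have := hmin p hp h2
      simp only [Set.mem_Iic] at h1
      linarith
    obtain ⟨f, u, v, hfu, huv, hfv⟩ := geometric_hahn_banach_compact_closed hconv hcomp
      ((convex_Iic m).prod (convex_Ici α)) (isClosed_Iic.prod isClosed_Ici) hdisj
    have hf : ∀ x y : ℝ, f (x, y) = x * f (1, 0) + y * f (0, 1) := by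
      intro x y
      have : ((x, y) : ℝ × ℝ) = x • ((1, 0) : ℝ × ℝ) + y • ((0, 1) : ℝ × ℝ) := by simp
      rw [this, map_add, map_smul, map_smul, smul_eq_mul, smul_eq_mul]
    generalize f (1, 0) = a at hf
    generalize f (0, 1) = b at hf
    have hv : ∀ x y : ℝ, x ≤ m → α ≤ y → v < x * a + y * b := by
      intro x y hx hy
      have := hfv (x, y) ⟨hx, hy⟩
      rwa [hf] at this
    have hu : ∀ p ∈ S, p.1 * a + p.2 * b < u := by
      intro p hp
      have := hfu p hp
      rwa [← Prod.mk.eta (p := p), hf] at this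
    have h0 := hv m α le_rfl le_rfl
    have ha : a ≤ 0 := by
      by_contra! h
      have h1 := hv (m - (m * a + α * b - v) / a) α
        (by have : 0 ≤ (m * a + α * b - v) / a := div_nonneg (by linarith) h.le
            linarith) le_rfl
      rw [sub_mul, div_mul_cancel₀ _ h.ne'] at h1
      linarith
    have hb : 0 ≤ b := by
      by_contra! h
      have h1 := hv m (α + (m * a + α * b - v) / (-b)) le_rfl
        (by have : 0 ≤ (m * a + α * b - v) / (-b) := div_nonneg (by linarith) (by linarith)
            linarith)
      have h2 : (m * a + α * b - v) / (-b) * b = -(m * a + α * b - v) := by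
        field_simp [h.ne]
      rw [add_mul, h2] at h1
      linarith
    have ha' : a < 0 := by
      refine lt_of_le_of_ne ha ?_
      rintro rfl
      have h1 := hu q hqS
      have h2 := mul_le_mul_of_nonneg_right hqα hb
      linarith
    refine ⟨_, ⟨b / (-a), div_nonneg hb (by linarith), rfl⟩, hwm.trans_le ?_⟩
    apply le_csInf (hS.image _)
    rintro _ ⟨p, hp, rfl⟩
    have h1 := hu p hp
    have h2 : b = b / (-a) * (-a) := by rw [div_mul_cancel₀]; linarith
    simp only
    generalize b / (-a) = l at h2
    subst h2
    by_contra! h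
    nlinarith [mul_lt_mul_of_pos_right h (neg_pos.2 ha')]
end

section
/- Let S be a nonempty, convex, compact subset of ℝ × ℝ, let α ∈ ℝ, and suppose there exists (C, V) ∈ S with V > α (Slater condition). If (C*, V*) ∈ S satisfies V* ≥ α and C* ≤ C for every (C, V) ∈ S with V ≥ α (i.e., (C*, V*) is optimal for the constrained problem), then there exists λ ≥ 0 such that (C*, V*) is λ-optimal in S, i.e., C* - λ·V* ≤ C - λ·V for all (C, V) ∈ S. -/
/-- Existence of a supporting multiplier under Slater's condition: if `S ⊆ ℝ × ℝ` is
nonempty, convex and compact, there exists `(C, V) ∈ S` with `V > α`, and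
`(C*, V*) ∈ S` is optimal for the constrained problem `min { C : (C, V) ∈ S, V ≥ α }`,
then there exists `λ ≥ 0` such that `(C*, V*)` is λ-optimal in `S`. -/
theorem supporting_multiplier_exists
    (S : Set (ℝ × ℝ)) (hS : S.Nonempty) (hconv : Convex ℝ S) (hcomp : IsCompact S)
    (α : ℝ) (hslater : ∃ p ∈ S, α < p.2)
    (Cstar Vstar : ℝ) (hmem : (Cstar, Vstar) ∈ S) (hfeas : α ≤ Vstar)
    (hopt : ∀ p ∈ S, α ≤ p.2 → Cstar ≤ p.1) :
    ∃ lam : ℝ, 0 ≤ lam ∧ ∀ p ∈ S, Cstar - lam * Vstar ≤ p.1 - lam * p.2 := by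
  have key : ∀ p ∈ S, α < p.2 → ∀ q ∈ S, q.2 < α →
      (Cstar - q.1) / (α - q.2) ≤ (p.1 - Cstar) / (p.2 - α) := by
    intro p hp hpα q hq hqα
    have hd : 0 < p.2 - q.2 := by linarith
    have hm := hconv hq hp (a := (p.2 - α) / (p.2 - q.2)) (b := (α - q.2) / (p.2 - q.2))
      (div_nonneg (by linarith) hd.le) (div_nonneg (by linarith) hd.le)
      (by field_simp; ring)
    have h := hopt _ hm (by
      apply le_of_eq
      simp only [Prod.snd_add, Prod.smul_snd, smul_eq_mul]
      field_simp
      ring)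
    simp only [Prod.fst_add, Prod.smul_fst, smul_eq_mul] at h
    have e : (p.2 - α) / (p.2 - q.2) * q.1 + (α - q.2) / (p.2 - q.2) * p.1
        = ((p.2 - α) * q.1 + (α - q.2) * p.1) / (p.2 - q.2) := by ring
    rw [e, le_div_iff₀ hd] at h
    rw [div_le_div_iff₀ (by linarith) (by linarith)]
    linarith
  let T : Set ℝ := {r | r = 0 ∨ ∃ q ∈ S, q.2 < α ∧ r = (Cstar - q.1) / (α - q.2)}
  have hub : ∀ p ∈ S, α < p.2 → (p.1 - Cstar) / (p.2 - α) ∈ upperBounds T := by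
    rintro p hp hpα r (rfl | ⟨q, hq, hqα, rfl⟩)
    · exact div_nonneg (by linarith [hopt p hp hpα.le]) (by linarith)
    · exact key p hp hpα q hq hqα
  obtain ⟨p0, hp0, hp0α⟩ := hslater
  have hbdd : BddAbove T := ⟨_, hub p0 hp0 hp0α⟩
  have h0 : (0 : ℝ) ∈ T := Or.inl rfl
  have hl0 : 0 ≤ sSup T := le_csSup hbdd h0
  refine ⟨sSup T, hl0, fun p hp => ?_⟩
  have h1 : sSup T * α ≤ sSup T * Vstar := mul_le_mul_of_nonneg_left hfeas hl0
  rcases lt_trichotomy p.2 α with h | h | h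
  · have h2 : (Cstar - p.1) / (α - p.2) ≤ sSup T := le_csSup hbdd (Or.inr ⟨p, hp, h, rfl⟩)
    rw [div_le_iff₀ (by linarith)] at h2
    linarith
  · have h2 := hopt p hp h.ge
    rw [h]
    linarith
  · have h2 : sSup T ≤ (p.1 - Cstar) / (p.2 - α) := csSup_le ⟨0, h0⟩ (hub p hp h)
    rw [le_div_iff₀ (by linarith)] at h2
    linarith
end

section
/- Let S be a nonempty, convex, compact subset of ℝ × ℝ and let α ∈ ℝ. Define Λ = { λ ≥ 0 : there exists (C, V) ∈ S which is λ-optimal in S and satisfies V ≥ α }. Suppose λ* is a minimum of Λ, i.e., λ* ∈ Λ and λ* ≤ λ for all λ ∈ Λ. Then there exists (C*, V*) ∈ S that is λ*-optimal in S, satisfies V* ≥ α, and satisfies C* ≤ C for every (C, V) ∈ S with V ≥ α; that is, (C*, V*) is optimal for the constrained problem min{ C : (C, V) ∈ S, V ≥ α }. -/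
/-- Equivalence of the joint chance constrained problem and the bilevel problem:
let `S ⊆ ℝ × ℝ` be nonempty, convex and compact, and let
`Λ = { λ ≥ 0 : ∃ (C, V) ∈ S λ-optimal in S with V ≥ α }`. If `λ*` is a minimum of `Λ`,
then there is a λ*-optimal pair `(C*, V*) ∈ S` with `V* ≥ α` which is optimal for the
constrained problem `min { C : (C, V) ∈ S, V ≥ α }`. -/
theorem bilevel_minimizer_solves_constrained_problem
    (S : Set (ℝ × ℝ)) (hS : S.Nonempty) (hconv : Convex ℝ S) (hcomp : IsCompact S)
    (α lamstar : ℝ) (hstar0 : 0 ≤ lamstar)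
    (hstarmem : ∃ p ∈ S, (∀ q ∈ S, p.1 - lamstar * p.2 ≤ q.1 - lamstar * q.2) ∧ α ≤ p.2)
    (hstarmin : ∀ lam : ℝ, 0 ≤ lam →
      (∃ p ∈ S, (∀ q ∈ S, p.1 - lam * p.2 ≤ q.1 - lam * q.2) ∧ α ≤ p.2) →
      lamstar ≤ lam) :
    ∃ p ∈ S, (∀ q ∈ S, p.1 - lamstar * p.2 ≤ q.1 - lamstar * q.2) ∧ α ≤ p.2 ∧
      ∀ q ∈ S, α ≤ q.2 → p.1 ≤ q.1 := by
  obtain ⟨p, hp, hopt, hpα⟩ := hstarmem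
  rcases hstar0.eq_or_lt with h0 | hpos
  · refine ⟨p, hp, hopt, hpα, fun q hq _ => ?_⟩
    have := hopt q hq
    rw [← h0] at this
    linarith
  -- for every multiplier below `lamstar`, there is an optimizer with safety below `α`
  have key : ∀ lam : ℝ, 0 ≤ lam → lam < lamstar →
      ∃ r ∈ S, (∀ q ∈ S, r.1 - lam * r.2 ≤ q.1 - lam * q.2) ∧ r.2 < α := by
    intro lam hl hlt
    obtain ⟨r, hr, hmin⟩ := hcomp.exists_isMinOn hS
      (f := fun q : ℝ × ℝ => q.1 - lam * q.2) (by fun_prop)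
    have hmin' : ∀ q ∈ S, r.1 - lam * r.2 ≤ q.1 - lam * q.2 := fun q hq => hmin hq
    refine ⟨r, hr, hmin', ?_⟩
    by_contra hcon
    exact absurd (hstarmin lam hl ⟨r, hr, hmin', not_lt.mp hcon⟩) (not_le.mpr hlt)
  -- a `lamstar`-optimal point with safety at most `α`
  have hq : ∃ q ∈ S, q.1 - lamstar * q.2 ≤ p.1 - lamstar * p.2 ∧ q.2 ≤ α := by
    obtain ⟨r0, hr0, -, hr0α⟩ := key 0 le_rfl hpos
    have hT : IsCompact (S ∩ {q : ℝ × ℝ | q.2 ≤ α}) :=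
      hcomp.inter_right (isClosed_le (by fun_prop) (by fun_prop))
    obtain ⟨q0, hq0, hmin⟩ := hT.exists_isMinOn ⟨r0, hr0, hr0α.le⟩
      (f := fun q : ℝ × ℝ => q.1 - lamstar * q.2) (by fun_prop)
    have hmin' : ∀ q ∈ S, q.2 ≤ α → q0.1 - lamstar * q0.2 ≤ q.1 - lamstar * q.2 :=
      fun q hq hqα => hmin ⟨hq, hqα⟩
    refine ⟨q0, hq0.1, ?_, hq0.2⟩
    by_contra hcon
    obtain ⟨w, hw, hwmin⟩ := hcomp.exists_isMinOn hS
      (f := fun q : ℝ × ℝ => q.2) (by fun_prop)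
    have hwmin' : ∀ q ∈ S, w.2 ≤ q.2 := fun q hq => hwmin hq
    obtain ⟨g, hg⟩ : ∃ g, g = (q0.1 - lamstar * q0.2) - (p.1 - lamstar * p.2) := ⟨_, rfl⟩
    have hgpos : 0 < g := by linarith [not_le.mp hcon]
    obtain ⟨D, hD⟩ : ∃ D, D = p.2 - w.2 := ⟨_, rfl⟩
    have hD0 : 0 ≤ D := by linarith [hwmin' p hp]
    obtain ⟨e, he⟩ : ∃ e, e = min lamstar (g / (D + 1)) := ⟨_, rfl⟩
    have hepos : 0 < e := by rw [he]; exact lt_min hpos (by positivity)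
    have hele : e ≤ lamstar := by rw [he]; exact min_le_left _ _
    have heg : e * (D + 1) ≤ g := by
      rw [← le_div_iff₀ (by linarith), he]; exact min_le_right _ _
    obtain ⟨r, hr, hropt, hrα⟩ := key (lamstar - e) (by linarith) (by linarith)
    have h1 := hropt p hp
    have h2 := hmin' r hr hrα.le
    have h3 : e * (p.2 - r.2) ≤ e * D :=
      mul_le_mul_of_nonneg_left (by linarith [hwmin' r hr]) hepos.le
    nlinarith
  obtain ⟨q, hqS, hqopt, hqα⟩ := hq
  -- a `lamstar`-optimal point with safety exactly `α`
  have hx : ∃ x ∈ S, x.1 - lamstar * x.2 ≤ p.1 - lamstar * p.2 ∧ x.2 = α := by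
    rcases hqα.eq_or_lt with h | h
    · exact ⟨q, hqS, hqopt, h⟩
    have hd : 0 < p.2 - q.2 := by linarith
    obtain ⟨t, ht⟩ : ∃ t, t = (α - q.2) / (p.2 - q.2) := ⟨_, rfl⟩
    have ht0 : 0 ≤ t := by rw [ht]; exact div_nonneg (by linarith) hd.le
    have ht1 : t ≤ 1 := by rw [ht, div_le_one hd]; linarith
    have hte : t * (p.2 - q.2) = α - q.2 := by rw [ht]; field_simp
    refine ⟨t • p + (1 - t) • q, hconv hp hqS ht0 (by linarith) (by ring), ?_, ?_⟩
    · simp only [Prod.fst_add, Prod.snd_add, Prod.smul_fst, Prod.smul_snd, smul_eq_mul]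
      have := mul_le_mul_of_nonneg_left hqopt (sub_nonneg.mpr ht1)
      linarith
    · simp only [Prod.snd_add, Prod.smul_snd, smul_eq_mul]
      linarith
  obtain ⟨x, hxS, hxopt, hxα⟩ := hx
  refine ⟨x, hxS, fun y hy => hxopt.trans (hopt y hy), hxα.ge, fun y hy hyα => ?_⟩
  have h1 := hxopt.trans (hopt y hy)
  have h2 := mul_le_mul_of_nonneg_left hyα hstar0
  rw [hxα] at h1
  linarith
end

section
/- Let S be a nonempty subset of ℝ × ℝ, let (C_, V_) ∈ S satisfy C_ ≤ C for all (C, V) ∈ S (a minimum-cost pair), and let (C̄, V̄) ∈ S satisfy V̄ ≥ V for all (C, V) ∈ S (a maximum-safety pair). Let α ∈ ℝ satisfy α < V̄, assume C_ < C̄, and set λ̄ = (C̄ - C_)/(V̄ - α) > 0. Then every pair (Cλ, Vλ) ∈ S that is λ̄-optimal in S satisfies Vλ ≥ α. -/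
/-- Bounds on λ*: let `(C_, V_) ∈ S` be a minimum-cost pair and `(C̄, V̄) ∈ S` a
maximum-safety pair, with `α < V̄` and `C_ < C̄`, and set `λ̄ = (C̄ - C_)/(V̄ - α)`.
Then every λ̄-optimal pair `(Cλ, Vλ) ∈ S` satisfies `Vλ ≥ α`. -/
theorem initial_upper_bound_on_lambda
    (S : Set (ℝ × ℝ)) (hS : S.Nonempty)
    (Cmin Vmin : ℝ) (hminmem : (Cmin, Vmin) ∈ S)
    (hmin : ∀ p ∈ S, Cmin ≤ p.1)
    (Cbar Vbar : ℝ) (hbarmem : (Cbar, Vbar) ∈ S)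
    (hmax : ∀ p ∈ S, p.2 ≤ Vbar)
    (α : ℝ) (hα : α < Vbar) (hC : Cmin < Cbar) :
    ∀ Cl Vl : ℝ, (Cl, Vl) ∈ S →
      (∀ p ∈ S, Cl - ((Cbar - Cmin) / (Vbar - α)) * Vl ≤
        p.1 - ((Cbar - Cmin) / (Vbar - α)) * p.2) →
      α ≤ Vl := by
  intro Cl Vl hl hopt
  have h1 := hopt _ hbarmem
  have h2 := hmin _ hl
  have hd : 0 < Vbar - α := sub_pos.mpr hα
  have hpos : 0 < (Cbar - Cmin) / (Vbar - α) := div_pos (sub_pos.mpr hC) hd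
  have heq : (Cbar - Cmin) / (Vbar - α) * (Vbar - α) = Cbar - Cmin :=
    div_mul_cancel₀ _ hd.ne'
  generalize (Cbar - Cmin) / (Vbar - α) = l at *
  simp only at h1 h2
  have h3 : l * α ≤ l * Vl := by linarith
  exact le_of_mul_le_mul_left h3 hpos
end

section
/- Let S be a nonempty subset of ℝ × ℝ, let 0 ≤ λ_ ≤ λ̄, let (C₁, V₁) ∈ S be λ_-optimal in S and (C₂, V₂) ∈ S be λ̄-optimal in S, and assume V₁ ≤ α ≤ V₂ and V₁ < V₂. Set p = (α - V₁)/(V₂ - V₁) ∈ [0, 1]. Then for every (C, V) in the convex hull of S with V ≥ α, p·C₂ + (1-p)·C₁ - C ≤ p·(1-p)·(λ̄ - λ_)·(V₂ - V₁). -/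
/-- Suboptimality bound for the mixed policy produced by bisection: let
`(C₁, V₁) ∈ S` be λ̲-optimal and `(C₂, V₂) ∈ S` be λ̄-optimal with `0 ≤ λ̲ ≤ λ̄`,
`V₁ ≤ α ≤ V₂` and `V₁ < V₂`, and set `p = (α - V₁)/(V₂ - V₁)`. Then for every
`(C, V)` in the convex hull of `S` with `V ≥ α`,
`p·C₂ + (1-p)·C₁ - C ≤ p·(1-p)·(λ̄ - λ̲)·(V₂ - V₁)`. -/
theorem mixed_policy_suboptimality_bound
    (S : Set (ℝ × ℝ)) (hS : S.Nonempty)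
    (α lamlo lamhi : ℝ) (hlo : 0 ≤ lamlo) (hlohi : lamlo ≤ lamhi)
    (C₁ V₁ C₂ V₂ : ℝ)
    (h₁ : (C₁, V₁) ∈ S) (h₂ : (C₂, V₂) ∈ S)
    (hopt₁ : ∀ p ∈ S, C₁ - lamlo * V₁ ≤ p.1 - lamlo * p.2)
    (hopt₂ : ∀ p ∈ S, C₂ - lamhi * V₂ ≤ p.1 - lamhi * p.2)
    (hV₁ : V₁ ≤ α) (hV₂ : α ≤ V₂) (hVlt : V₁ < V₂) :
    ∀ p ∈ convexHull ℝ S, α ≤ p.2 →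
      ((α - V₁) / (V₂ - V₁)) * C₂ + (1 - (α - V₁) / (V₂ - V₁)) * C₁ - p.1 ≤
        ((α - V₁) / (V₂ - V₁)) * (1 - (α - V₁) / (V₂ - V₁)) * (lamhi - lamlo) *
          (V₂ - V₁) := by
  intro q hq hα
  have key : ∀ l c : ℝ, (∀ p ∈ S, c ≤ p.1 - l * p.2) → c ≤ q.1 - l * q.2 := by
    intro l c h
    have hconv : Convex ℝ {x : ℝ × ℝ | c ≤ x.1 - l * x.2} := by
      intro x hx y hy a b ha hb hab
      simp only [Set.mem_setOf_eq, Prod.fst_add, Prod.snd_add, Prod.smul_fst, Prod.smul_snd,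
        smul_eq_mul] at *
      have e : c = a * c + b * c := by rw [← add_mul, hab, one_mul]
      have := mul_le_mul_of_nonneg_left hx ha
      have := mul_le_mul_of_nonneg_left hy hb
      linarith
    exact convexHull_min (fun x hx => h x hx) hconv hq
  have k₁ := key _ _ hopt₁
  have k₂ := key _ _ hopt₂
  have hD : 0 < V₂ - V₁ := sub_pos.2 hVlt
  have hp0 : 0 ≤ (α - V₁) / (V₂ - V₁) := div_nonneg (sub_nonneg.2 hV₁) hD.le
  have hp1 : (α - V₁) / (V₂ - V₁) ≤ 1 := by
    rw [div_le_one hD]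
    linarith
  have hpD : (α - V₁) / (V₂ - V₁) * (V₂ - V₁) = α - V₁ := div_mul_cancel₀ _ hD.ne'
  generalize (α - V₁) / (V₂ - V₁) = t at *
  have m₁ := mul_le_mul_of_nonneg_left hα hlo
  have m₂ := mul_le_mul_of_nonneg_left hα (hlo.trans hlohi)
  have hα' : α = V₁ + t * (V₂ - V₁) := by linarith
  have b₁ : C₁ - lamlo * V₁ + lamlo * α ≤ q.1 := by linarith
  have b₂ : C₂ - lamhi * V₂ + lamhi * α ≤ q.1 := by linarith
  have w₁ := mul_le_mul_of_nonneg_left b₁ (sub_nonneg.2 hp1)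
  have w₂ := mul_le_mul_of_nonneg_left b₂ hp0
  rw [hα'] at w₁ w₂
  linarith
end

section
/- Let X be a measurable space, let U be a nonempty compact metric space equipped with its Borel σ-algebra, and let F : X × U → ℝ be such that for every x ∈ X the map u ↦ F(x, u) is continuous and for every u ∈ U the map x ↦ F(x, u) is measurable. Then: (i) the value function x ↦ inf{ F(x, u) : u ∈ U } is measurable; and (ii) there exists a measurable map μ : X → U such that F(x, μ(x)) = inf{ F(x, u) : u ∈ U } for every x ∈ X, i.e., the infimum is attained by a measurable selector. -/
open Set TopologicalSpace in
/-- The infimum of a Carathéodory function over a compact space is measurable. -/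
theorem measurable_iInf_aux {X K : Type*} [MeasurableSpace X]
    [TopologicalSpace K] [CompactSpace K] [SeparableSpace K] [Nonempty K]
    (F : X → K → ℝ) (hcont : ∀ x, Continuous (F x))
    (hmeas : ∀ u, Measurable fun x => F x u) :
    Measurable (fun x => ⨅ u, F x u) := by
  have hb : ∀ x, BddBelow (range (F x)) := fun x => (isCompact_range (hcont x)).bddBelow
  have h : (fun x => ⨅ u, F x u) = fun x => ⨅ n, F x (denseSeq K n) := by
    funext x
    have hb' : BddBelow (range fun n => F x (denseSeq K n)) :=
      (hb x).mono (by rintro _ ⟨n, rfl⟩; exact ⟨_, rfl⟩)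
    apply le_antisymm
    · exact le_ciInf fun n => ciInf_le (hb x) _
    · refine le_ciInf fun u => ?_
      have hc : IsClosed {u | (⨅ n, F x (denseSeq K n)) ≤ F x u} :=
        isClosed_le continuous_const (hcont x)
      have hs : range (denseSeq K) ⊆ {u | (⨅ n, F x (denseSeq K n)) ≤ F x u} := by
        rintro _ ⟨n, rfl⟩
        exact ciInf_le hb' n
      exact hc.closure_subset_iff.2 hs (denseRange_denseSeq K u)
  rw [h]
  exact Measurable.iInf fun n => hmeas _

/-- The infimum of a continuous function over a compact space is attained. -/
theorem exists_eq_iInf_aux {K : Type*} [TopologicalSpace K] [CompactSpace K] [Nonempty K]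
    (f : K → ℝ) (hf : Continuous f) : ∃ u, f u = ⨅ v, f v := by
  obtain ⟨u, -, hu⟩ := isCompact_univ.exists_isMinOn Set.univ_nonempty hf.continuousOn
  exact ⟨u, le_antisymm (le_ciInf fun v => hu (Set.mem_univ v))
    (ciInf_le (isCompact_range hf).bddBelow u)⟩

/-- Measurable selection for Carathéodory functions on a compact metric input space:
if `F : X × U → ℝ` is continuous in `u` for each `x` and measurable in `x` for each
`u`, then the value function `x ↦ inf_{u ∈ U} F(x, u)` is measurable and the infimum
is attained by a measurable selector `μ : X → U`. -/
theorem measurable_selection_compact_inputs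
    {X U : Type*} [MeasurableSpace X]
    [MetricSpace U] [CompactSpace U] [Nonempty U]
    [MeasurableSpace U] [BorelSpace U]
    (F : X × U → ℝ)
    (hcont : ∀ x : X, Continuous fun u : U => F (x, u))
    (hmeas : ∀ u : U, Measurable fun x : X => F (x, u)) :
    Measurable (fun x : X => ⨅ u : U, F (x, u)) ∧
      ∃ μ : X → U, Measurable μ ∧ ∀ x : X, F (x, μ x) = ⨅ u : U, F (x, u) := by
  have hv : Measurable (fun x : X => ⨅ u : U, F (x, u)) :=
    measurable_iInf_aux (fun x u => F (x, u)) hcont hmeas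
  refine ⟨hv, ?_⟩
  -- a continuous surjection from the Cantor set onto `U`
  obtain ⟨φ, hφ, hφs⟩ : ∃ φ : cantorSet → U, Continuous φ ∧ Function.Surjective φ := by
    obtain ⟨f, hf, hfs⟩ := exists_nat_bool_continuous_surjective_of_compact U
    exact ⟨f ∘ cantorSetHomeomorphNatToBool, hf.comp cantorSetHomeomorphNatToBool.continuous,
      hfs.comp cantorSetHomeomorphNatToBool.surjective⟩
  have : CompactSpace cantorSet := isCompact_iff_compactSpace.1 isCompact_cantorSet
  -- the least parameter of a minimizer
  have hleast : ∀ x, ∃ t : cantorSet, F (x, φ t) = (⨅ u : U, F (x, u)) ∧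
      ∀ s : cantorSet, F (x, φ s) = (⨅ u : U, F (x, u)) → (t : ℝ) ≤ s := by
    intro x
    have hcl : IsClosed {t : cantorSet | F (x, φ t) = ⨅ u : U, F (x, u)} :=
      isClosed_eq ((hcont x).comp hφ) continuous_const
    have hne : {t : cantorSet | F (x, φ t) = ⨅ u : U, F (x, u)}.Nonempty := by
      obtain ⟨u, hu⟩ := exists_eq_iInf_aux _ (hcont x)
      obtain ⟨t, rfl⟩ := hφs u
      exact ⟨t, hu⟩
    obtain ⟨t, ht, hmin⟩ := hcl.isCompact.exists_isMinOn hne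
      (continuous_subtype_val (p := fun r : ℝ => r ∈ cantorSet)).continuousOn
    exact ⟨t, ht, fun s hs => hmin hs⟩
  choose m hm hmin using hleast
  refine ⟨fun x => φ (m x), hφ.measurable.comp ?_, hm⟩
  have hval : Measurable fun x => ((m x : cantorSet) : ℝ) := by
    refine measurable_of_Iic fun c => ?_
    by_cases hc : Nonempty {t : cantorSet // (t : ℝ) ≤ c}
    · have hcl : IsClosed {t : cantorSet | (t : ℝ) ≤ c} :=
        isClosed_le continuous_subtype_val continuous_const
      have : CompactSpace {t : cantorSet // (t : ℝ) ≤ c} :=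
        isCompact_iff_compactSpace.1 hcl.isCompact
      have hcc : ∀ x, Continuous fun t : {t : cantorSet // (t : ℝ) ≤ c} => F (x, φ t.1) :=
        fun x => (hcont x).comp (hφ.comp continuous_subtype_val)
      have hw : Measurable fun x => ⨅ t : {t : cantorSet // (t : ℝ) ≤ c}, F (x, φ t.1) :=
        measurable_iInf_aux (fun x (t : {t : cantorSet // (t : ℝ) ≤ c}) => F (x, φ t.1)) hcc
          fun t => hmeas _
      convert measurableSet_le hw hv using 1
      ext x
      simp only [Set.mem_preimage, Set.mem_Iic, Set.mem_setOf_eq]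
      constructor
      · intro h
        rw [← hm x]
        exact ciInf_le (isCompact_range (hcc x)).bddBelow ⟨m x, h⟩
      · intro h
        obtain ⟨t, ht⟩ := exists_eq_iInf_aux _ (hcc x)
        refine (hmin x t.1 (le_antisymm (ht.trans_le h) ?_)).trans t.2
        exact ciInf_le (isCompact_range (hcont x)).bddBelow _
    · convert MeasurableSet.empty using 1
      ext x
      simp only [Set.mem_preimage, Set.mem_Iic, Set.mem_empty_iff_false, iff_false]
      exact fun h => hc ⟨⟨m x, h⟩⟩
  exact hval.subtype_mk (h := fun x => (m x).2)
end
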